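/- arXiv:2007.07946 — 3 statements merged into one kernel-verified Lean document; each statement's English description precedes it below -/
import Mathlib

section
/- Let (X_t)_{t≥0} be an infinite time horizon Brownian bridge with jointly measurable sample paths whose coefficient α is continuous and positive. Then for every x ∈ ℝ and every 0 < t < ∞, the family of approximating local times is Cauchy in L²: lim_{ε,θ → 0+} E| L^x_{t,ε} − L^x_{t,θ} |² = 0. -/
open MeasureTheory ProbabilityTheory Real Filter Set

/-- `Aint α t = ∫₀ᵗ α(u) du`. -/
noncomputable def Aint (α : ℝ → ℝ) (t : ℝ) : ℝ := ∫ u in (0:ℝ)..t, α u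

/-- `alphaStar α t = sup_{0 ≤ r ≤ t} α(r)`. -/
noncomputable def alphaStar (α : ℝ → ℝ) (t : ℝ) : ℝ := sSup (α '' Set.Icc 0 t)

/-- Covariance kernel of the infinite time horizon Brownian bridge. -/
noncomputable def Kker (α : ℝ → ℝ) (s t : ℝ) : ℝ :=
  Real.exp (-(Aint α s) - Aint α t) * ∫ u in (0:ℝ)..(min s t), Real.exp (2 * Aint α u)

/-- `X` is an infinite time horizon Brownian bridge associated with coefficient `α`:
every finite real linear combination of the `X_{t_i}` (for `t_i ≥ 0`) is a centered
Gaussian random variable, and the covariance is given by the kernel `Kker α`. -/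
def IsBridge {Ω : Type*} [MeasurableSpace Ω] (P : Measure Ω) (α : ℝ → ℝ)
    (X : ℝ → Ω → ℝ) : Prop :=
  (∀ (n : ℕ) (c t : Fin n → ℝ), (∀ i, 0 ≤ t i) →
    ∃ v : NNReal, P.map (fun ω => ∑ i, c i * X (t i) ω) = gaussianReal 0 v) ∧
  (∀ s t : ℝ, 0 ≤ s → 0 ≤ t → ∫ ω, X s ω * X t ω ∂P = Kker α s t)

/-- Growth conditions (i) and (ii) on `α`, with parameters `γ ∈ [0,1/2]`, `β > 0`. -/
def GrowthCond (α : ℝ → ℝ) (γ β : ℝ) : Prop :=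
  ContDiffOn ℝ 1 α (Set.Ici 0) ∧ γ ∈ Set.Icc (0:ℝ) (1/2) ∧ 0 < β ∧
    (∃ C > (0:ℝ), ∀ t > (0:ℝ), (alphaStar α (t+1)) ^ (2*γ) / α t ≤ C * t ^ (-β)) ∧
    (∃ C : ℝ, ∀ t ≥ (0:ℝ), |deriv α t / α t| ≤ C)

/-- The approximating local time `L^x_{t,ε} = ∫₀ᵗ (2πε)^{-1/2} exp(-(X_r - x)²/(2ε)) dr`. -/
noncomputable def locApprox {Ω : Type*} (X : ℝ → Ω → ℝ) (x ε t : ℝ) (ω : Ω) : ℝ :=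
  ∫ r in (0:ℝ)..t, (Real.sqrt (2 * Real.pi * ε))⁻¹ * Real.exp (-(X r ω - x)^2 / (2*ε))

/-- The variance of `ξ X_r + η X_s` for a bridge `X` with coefficient `α`. -/
noncomputable def bridgeVar (α : ℝ → ℝ) (r s ξ η : ℝ) : ℝ :=
  ξ ^ 2 * Kker α r r + 2 * ξ * η * Kker α r s + η ^ 2 * Kker α s s

lemma Kker_comm (α : ℝ → ℝ) (s t : ℝ) : Kker α s t = Kker α t s := by
  rw [Kker, Kker, min_comm, neg_sub_left, neg_sub_left, add_comm]

lemma bridgeVar_swap (α : ℝ → ℝ) (r s ξ η : ℝ) :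
    bridgeVar α s r η ξ = bridgeVar α r s ξ η := by
  rw [bridgeVar, bridgeVar, Kker_comm α s r]; ring

lemma Kker_congr {α α' : ℝ → ℝ} (h : EqOn α α' (Ici 0)) {s t : ℝ} (hs : 0 ≤ s) (ht : 0 ≤ t) :
    Kker α s t = Kker α' s t := by
  have hA : EqOn (Aint α) (Aint α') (Ici 0) := fun u hu => by
    refine intervalIntegral.integral_congr fun v hv => h ?_
    rw [uIcc_of_le hu] at hv
    exact hv.1
  rw [Kker, Kker, hA hs, hA ht]
  congr 1
  refine intervalIntegral.integral_congr fun v hv => ?_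
  rw [uIcc_of_le (le_min hs ht)] at hv
  simp only [hA hv.1]

lemma IsBridge.congr {Ω : Type*} [MeasurableSpace Ω] {P : Measure Ω} {α α' : ℝ → ℝ}
    {X : ℝ → Ω → ℝ} (hX : IsBridge P α X) (h : EqOn α α' (Ici 0)) : IsBridge P α' X :=
  ⟨hX.1, fun s t hs ht => (hX.2 s t hs ht).trans (Kker_congr h hs ht)⟩

section Kernel

variable {α : ℝ → ℝ}

lemma continuous_Aint (hα : Continuous α) : Continuous (Aint α) :=
  intervalIntegral.continuous_primitive (fun a b => hα.intervalIntegrable a b) 0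

lemma continuous_exp_two_mul_Aint (hα : Continuous α) :
    Continuous fun u => Real.exp (2 * Aint α u) :=
  Real.continuous_exp.comp (continuous_const.mul (continuous_Aint hα))

lemma continuous_Kker (hα : Continuous α) :
    Continuous fun p : ℝ × ℝ => Kker α p.1 p.2 := by
  have hA := continuous_Aint hα
  have hT : Continuous fun v : ℝ => ∫ u in (0:ℝ)..v, Real.exp (2 * Aint α u) :=
    intervalIntegral.continuous_primitive
      (fun a b => (continuous_exp_two_mul_Aint hα).intervalIntegrable a b) 0
  have := hT.comp (continuous_fst.min continuous_snd : Continuous fun p : ℝ × ℝ => min p.1 p.2)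
  unfold Kker
  simp only [Function.comp_def] at this
  fun_prop

lemma Aint_mono (hα : Continuous α) (hpos : ∀ u, 0 < α u) : Monotone (Aint α) := fun u v huv => by
  rw [← sub_nonneg, Aint, Aint, intervalIntegral.integral_interval_sub_left
    (hα.intervalIntegrable _ _) (hα.intervalIntegrable _ _)]
  exact intervalIntegral.integral_nonneg huv fun w _ => (hpos w).le

lemma sub_le_integral_exp (hα : Continuous α) (hpos : ∀ u, 0 < α u) {r s : ℝ}
    (hr : 0 ≤ r) (hrs : r ≤ s) :
    s - r ≤ ∫ u in r..s, Real.exp (2 * Aint α u) := by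
  have h1 : ∫ _ in r..s, (1 : ℝ) = s - r := by simp
  rw [← h1]
  refine intervalIntegral.integral_mono_on hrs (by simp)
    ((continuous_exp_two_mul_Aint hα).intervalIntegrable _ _) fun u hu => ?_
  have : Aint α 0 ≤ Aint α u := Aint_mono hα hpos (hr.trans hu.1)
  simp only [Aint, intervalIntegral.integral_same] at this
  exact Real.one_le_exp (by simp only [Aint]; linarith)

lemma le_bridgeVar (hα : Continuous α) (hpos : ∀ u, 0 < α u) {r s t : ℝ}
    (hr : 0 ≤ r) (hrs : r ≤ s) (hst : s ≤ t)
    (ξ η : ℝ) :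
    r * (ξ * Real.exp (-Aint α r) + η * Real.exp (-Aint α s)) ^ 2
      + (s - r) * Real.exp (-Aint α t) ^ 2 * η ^ 2 ≤ bridgeVar α r s ξ η := by
  have hT : Continuous fun u => Real.exp (2 * Aint α u) := continuous_exp_two_mul_Aint hα
  set a := Real.exp (-Aint α r) with ha
  set b := Real.exp (-Aint α s) with hb
  set p := ∫ u in (0:ℝ)..r, Real.exp (2 * Aint α u) with hp
  set q := ∫ u in r..s, Real.exp (2 * Aint α u) with hq
  have hpr : r ≤ p := by simpa using sub_le_integral_exp hα hpos le_rfl hr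
  have hqs : s - r ≤ q := sub_le_integral_exp hα hpos hr hrs
  have hpq : ∫ u in (0:ℝ)..s, Real.exp (2 * Aint α u) = p + q :=
    (intervalIntegral.integral_add_adjacent_intervals
      (hT.intervalIntegrable _ _) (hT.intervalIntegrable _ _)).symm
  have hbt : Real.exp (-Aint α t) ≤ b := by
    rw [hb]; gcongr; exact Aint_mono hα hpos hst
  have hK : bridgeVar α r s ξ η = p * (ξ * a + η * b) ^ 2 + q * b ^ 2 * η ^ 2 := by
    simp only [bridgeVar, Kker, min_self, min_eq_left hrs, hpq, sub_eq_add_neg, Real.exp_add,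
      ← ha, ← hb, ← hp]
    ring
  rw [hK]
  have : 0 ≤ s - r := by linarith
  have : 0 ≤ q := this.trans hqs
  gcongr

end Kernel

lemma lintegral_exp_neg_half_mul_sq {c : ℝ} (hc : 0 < c) :
    ∫⁻ x : ℝ, ENNReal.ofReal (Real.exp (-(c * x ^ 2) / 2))
      = ENNReal.ofReal √(2 * π / c) := by
  have h : ∀ x : ℝ, Real.exp (-(c * x ^ 2) / 2) = Real.exp (-(c / 2) * x ^ 2) := fun x => by
    congr 1; ring
  simp_rw [h]
  rw [← ofReal_integral_eq_lintegral_ofReal (integrable_exp_neg_mul_sq (by positivity))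
    (ae_of_all _ fun _ => by positivity), integral_gaussian]
  congr 2
  field_simp

/-- The Gaussian integral of `exp(-(r (ξ a + η b)² + q η²) / 2)` over the plane. -/
lemma lintegral_exp_neg_half_quadratic {r a q : ℝ} (hr : 0 < r) (ha : 0 < a) (hq : 0 < q)
    (b : ℝ) :
    ∫⁻ z : ℝ × ℝ, ENNReal.ofReal
        (Real.exp (-(r * (z.1 * a + z.2 * b) ^ 2 + q * z.2 ^ 2) / 2))
      = ENNReal.ofReal (√(2 * π / (r * a ^ 2)) * √(2 * π / q)) := by
  rw [Measure.volume_eq_prod, lintegral_prod_symm' _ (by fun_prop)]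
  have h : ∀ y x : ℝ, ENNReal.ofReal
        (Real.exp (-(r * (x * a + y * b) ^ 2 + q * y ^ 2) / 2))
      = ENNReal.ofReal (Real.exp (-((r * a ^ 2) * (x + y * b / a) ^ 2) / 2))
        * ENNReal.ofReal (Real.exp (-(q * y ^ 2) / 2)) := fun y x => by
    rw [← ENNReal.ofReal_mul (by positivity), ← Real.exp_add]
    congr 2
    field_simp
    ring
  simp_rw [h]
  simp_rw [lintegral_mul_const' _ _ ENNReal.ofReal_ne_top]
  have h2 : ∀ y : ℝ, ∫⁻ x : ℝ,
      ENNReal.ofReal (Real.exp (-((r * a ^ 2) * (x + y * b / a) ^ 2) / 2))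
        = ENNReal.ofReal √(2 * π / (r * a ^ 2)) := fun y => by
    rw [lintegral_add_right_eq_self
      (fun x : ℝ => ENNReal.ofReal (Real.exp (-((r * a ^ 2) * x ^ 2) / 2))) (y * b / a)]
    exact lintegral_exp_neg_half_mul_sq (by positivity)
  simp_rw [h2]
  rw [lintegral_const_mul' _ _ ENNReal.ofReal_ne_top, lintegral_exp_neg_half_mul_sq hq,
    ENNReal.ofReal_mul (by positivity)]

/-- The weight `u ↦ u^{-1/2}` on `(0, t]`, extended by zero. -/
noncomputable def invSqrtWeight (t u : ℝ) : ENNReal :=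
  (Ioc 0 t).indicator (fun u => ENNReal.ofReal (√u)⁻¹) u

lemma measurable_invSqrtWeight (t : ℝ) : Measurable (invSqrtWeight t) :=
  Measurable.indicator (by fun_prop) measurableSet_Ioc

lemma lintegral_invSqrtWeight_ne_top {t : ℝ} (ht : 0 ≤ t) :
    ∫⁻ u, invSqrtWeight t u ≠ ⊤ := by
  have h : IntegrableOn (fun u : ℝ => (√u)⁻¹) (Ioc 0 t) := by
    have := (intervalIntegrable_iff_integrableOn_Ioc_of_le ht).1
      (intervalIntegral.intervalIntegrable_rpow' (a := 0) (b := t) (r := -(1 / 2)) (by norm_num))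
    refine this.congr_fun (fun u hu => ?_) measurableSet_Ioc
    simp only
    rw [Real.rpow_neg hu.1.le, Real.sqrt_eq_rpow]
  unfold invSqrtWeight
  rw [lintegral_indicator measurableSet_Ioc]
  exact h.lintegral_lt_top.ne

lemma lintegral_invSqrtWeight_mul_sub (t : ℝ) :
    ∫⁻ r, ∫⁻ s, invSqrtWeight t r * invSqrtWeight t (s - r)
      = (∫⁻ u, invSqrtWeight t u) * ∫⁻ u, invSqrtWeight t u := by
  have h : ∀ r, ∫⁻ s, invSqrtWeight t r * invSqrtWeight t (s - r)
      = invSqrtWeight t r * ∫⁻ u, invSqrtWeight t u := fun r => by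
    have := measurable_invSqrtWeight t
    rw [lintegral_const_mul _ (f := fun s => invSqrtWeight t (s - r)) (by fun_prop),
      lintegral_sub_right_eq_self (invSqrtWeight t) r]
  simp_rw [h]
  rw [lintegral_mul_const _ (measurable_invSqrtWeight t)]

lemma lintegral_exp_neg_half_bridgeVar_le {α : ℝ → ℝ} (hα : Continuous α) (hpos : ∀ u, 0 < α u)
    {r s t : ℝ} (hr : 0 < r) (hrs : r < s) (hst : s ≤ t) :
    ∫⁻ z : ℝ × ℝ, ENNReal.ofReal (Real.exp (-bridgeVar α r s z.1 z.2 / 2))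
      ≤ ENNReal.ofReal (2 * π / Real.exp (-Aint α t) ^ 2)
        * (invSqrtWeight t r * invSqrtWeight t (s - r)) := by
  have hsr : 0 < s - r := sub_pos.2 hrs
  set c := Real.exp (-Aint α t)
  have hc0 : 0 < c := Real.exp_pos _
  calc _ ≤ ∫⁻ z : ℝ × ℝ, ENNReal.ofReal (Real.exp (-(r * (z.1 * Real.exp (-Aint α r)
        + z.2 * Real.exp (-Aint α s)) ^ 2 + ((s - r) * c ^ 2) * z.2 ^ 2) / 2)) := by
        refine lintegral_mono fun z => ?_
        gcongr
        exact le_bridgeVar hα hpos hr.le hrs.le hst _ _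
    _ = ENNReal.ofReal (√(2 * π / (r * Real.exp (-Aint α r) ^ 2))
          * √(2 * π / ((s - r) * c ^ 2))) :=
        lintegral_exp_neg_half_quadratic hr (Real.exp_pos _) (by positivity) _
    _ ≤ ENNReal.ofReal (√(2 * π / (r * c ^ 2)) * √(2 * π / ((s - r) * c ^ 2))) := by
        have hca : c ≤ Real.exp (-Aint α r) :=
          Real.exp_le_exp.2 (neg_le_neg (Aint_mono hα hpos (hrs.le.trans hst)))
        gcongr
    _ = _ := by
        rw [invSqrtWeight, invSqrtWeight, indicator_of_mem (by constructor <;> linarith),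
          indicator_of_mem (by constructor <;> linarith), ← ENNReal.ofReal_mul (by positivity),
          ← ENNReal.ofReal_mul (by positivity)]
        congr 1
        rw [Real.sqrt_div (by positivity), Real.sqrt_div (by positivity),
          Real.sqrt_mul hr.le, Real.sqrt_mul hsr.le, Real.sqrt_sq hc0.le]
        have h2 : √(2 * π) * √(2 * π) = 2 * π := Real.mul_self_sqrt (by positivity)
        have := Real.sqrt_pos.2 hr
        have := Real.sqrt_pos.2 hsr
        field_simp
        rw [sq, h2]

lemma lintegral_bridgeVar_swap (α : ℝ → ℝ) (r s : ℝ) :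
    ∫⁻ z : ℝ × ℝ, ENNReal.ofReal (Real.exp (-bridgeVar α s r z.1 z.2 / 2))
      = ∫⁻ z : ℝ × ℝ, ENNReal.ofReal (Real.exp (-bridgeVar α r s z.1 z.2 / 2)) := by
  rw [Measure.volume_eq_prod, ← lintegral_prod_swap]
  simp_rw [Prod.fst_swap, Prod.snd_swap, bridgeVar_swap]

lemma integrable_exp_neg_half_bridgeVar {α : ℝ → ℝ} (hα : Continuous α) (hpos : ∀ u, 0 < α u)
    {t : ℝ} (ht : 0 ≤ t) :
    Integrable (fun w : (ℝ × ℝ) × (ℝ × ℝ) =>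
        Real.exp (-bridgeVar α w.1.1 w.1.2 w.2.1 w.2.2 / 2))
      (((volume.restrict (Ioc 0 t)).prod (volume.restrict (Ioc 0 t))).prod volume) := by
  have hK := continuous_Kker hα
  have hcont : Continuous (fun w : (ℝ × ℝ) × (ℝ × ℝ) =>
      Real.exp (-bridgeVar α w.1.1 w.1.2 w.2.1 w.2.2 / 2)) := by
    have h1 : Continuous fun w : (ℝ × ℝ) × (ℝ × ℝ) => Kker α w.1.1 w.1.1 :=
      hK.comp (by fun_prop : Continuous fun w : (ℝ × ℝ) × (ℝ × ℝ) => (w.1.1, w.1.1))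
    have h2 : Continuous fun w : (ℝ × ℝ) × (ℝ × ℝ) => Kker α w.1.1 w.1.2 :=
      hK.comp (by fun_prop : Continuous fun w : (ℝ × ℝ) × (ℝ × ℝ) => (w.1.1, w.1.2))
    have h3 : Continuous fun w : (ℝ × ℝ) × (ℝ × ℝ) => Kker α w.1.2 w.1.2 :=
      hK.comp (by fun_prop : Continuous fun w : (ℝ × ℝ) × (ℝ × ℝ) => (w.1.2, w.1.2))
    unfold bridgeVar
    fun_prop
  refine ⟨hcont.aestronglyMeasurable, ?_⟩
  rw [hasFiniteIntegral_iff_ofReal (ae_of_all _ fun _ => by positivity)]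
  have hm : Measurable fun w : (ℝ × ℝ) × (ℝ × ℝ) =>
      ENNReal.ofReal (Real.exp (-bridgeVar α w.1.1 w.1.2 w.2.1 w.2.2 / 2)) :=
    hcont.measurable.ennreal_ofReal
  rw [lintegral_prod _ hm.aemeasurable, lintegral_prod _ hm.lintegral_prod_right'.aemeasurable]
  set C := ENNReal.ofReal (2 * π / Real.exp (-Aint α t) ^ 2)
  have hψ := measurable_invSqrtWeight t
  calc _ ≤ ∫⁻ r in Ioc 0 t, ∫⁻ s in Ioc 0 t, (C * (invSqrtWeight t r * invSqrtWeight t (s - r))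
          + C * (invSqrtWeight t s * invSqrtWeight t (r - s))) := by
        refine setLIntegral_mono' measurableSet_Ioc fun r hr => ?_
        refine lintegral_mono_ae ?_
        filter_upwards [ae_restrict_mem measurableSet_Ioc,
          ae_restrict_of_ae (Measure.ae_ne volume r)] with s hs hsr
        rcases lt_or_gt_of_ne hsr with h | h
        · rw [lintegral_bridgeVar_swap]
          exact (lintegral_exp_neg_half_bridgeVar_le hα hpos hs.1 h hr.2).trans le_add_self
        · exact (lintegral_exp_neg_half_bridgeVar_le hα hpos hr.1 h hs.2).trans le_self_add
    _ ≤ ∫⁻ r, ∫⁻ s, (C * (invSqrtWeight t r * invSqrtWeight t (s - r))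
          + C * (invSqrtWeight t s * invSqrtWeight t (r - s))) :=
        (setLIntegral_le_lintegral _ _).trans
          (lintegral_mono fun r => setLIntegral_le_lintegral _ _)
    _ = C * (∫⁻ r, ∫⁻ s, invSqrtWeight t r * invSqrtWeight t (s - r))
          + C * ∫⁻ r, ∫⁻ s, invSqrtWeight t s * invSqrtWeight t (r - s) := by
        have h1 : Measurable fun p : ℝ × ℝ =>
            invSqrtWeight t p.1 * invSqrtWeight t (p.2 - p.1) := by
          fun_prop
        have h2 : Measurable fun p : ℝ × ℝ =>
            invSqrtWeight t p.2 * invSqrtWeight t (p.1 - p.2) := by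
          fun_prop
        rw [← lintegral_const_mul _ h1.lintegral_prod_right',
          ← lintegral_const_mul _ h2.lintegral_prod_right',
          ← lintegral_add_left (h1.lintegral_prod_right'.const_mul _)]
        refine lintegral_congr fun r => ?_
        rw [lintegral_add_left (by fun_prop)]
        exact congrArg₂ (· + ·) (lintegral_const_mul _ (by fun_prop))
          (lintegral_const_mul _ (by fun_prop))
    _ < ⊤ := by
        rw [lintegral_lintegral_swap (f := fun r s => invSqrtWeight t s * invSqrtWeight t (r - s))
          (by fun_prop), lintegral_invSqrtWeight_mul_sub]
        have := (lintegral_invSqrtWeight_ne_top ht).lt_top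
        have hB := ENNReal.mul_lt_top (ENNReal.ofReal_lt_top (r := 2 * π / Real.exp (-Aint α t) ^ 2))
          (ENNReal.mul_lt_top this this)
        exact ENNReal.add_lt_top.2 ⟨hB, hB⟩

section CharFun

variable {Ω : Type*} [MeasurableSpace Ω] {P : Measure Ω} {α : ℝ → ℝ} {X : ℝ → Ω → ℝ}

lemma IsBridge.memLp_two (hX : IsBridge P α X) (hm : ∀ r, Measurable (X r)) {r : ℝ}
    (hr : 0 ≤ r) : MemLp (X r) 2 P := by
  obtain ⟨v, hv⟩ := hX.1 1 (fun _ => 1) (fun _ => r) fun _ => hr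
  simp only [Finset.univ_unique, Finset.sum_singleton, one_mul] at hv
  have := memLp_id_gaussianReal (μ := 0) (v := v) 2
  rw [← hv] at this
  exact (memLp_map_measure_iff aestronglyMeasurable_id (hm r).aemeasurable).1 this

/-- The joint characteristic function of two values of a bridge. -/
lemma IsBridge.integral_cexp (hX : IsBridge P α X)
    (hm : ∀ r, Measurable (X r)) {r s : ℝ} (hr : 0 ≤ r) (hs : 0 ≤ s) (ξ η : ℝ) :
    ∫ ω, Complex.exp (((ξ * X r ω + η * X s ω : ℝ) : ℂ) * Complex.I) ∂P
      = Complex.exp ((-bridgeVar α r s ξ η / 2 : ℝ) : ℂ) := by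
  obtain ⟨v, hv⟩ := hX.1 2 ![ξ, η] ![r, s] (by simp [Fin.forall_fin_two, hr, hs])
  simp only [Fin.sum_univ_two, Matrix.cons_val_zero, Matrix.cons_val_one] at hv
  have hmY : Measurable fun ω => ξ * X r ω + η * X s ω :=
    ((hm r).const_mul ξ).add ((hm s).const_mul η)
  have hLr := hX.memLp_two hm hr
  have hLs := hX.memLp_two hm hs
  have hvar : (v : ℝ) = bridgeVar α r s ξ η := by
    have h1 : (v : ℝ) = ∫ x, x ^ 2 ∂gaussianReal 0 v := by
      have h := variance_fun_id_gaussianReal (μ := 0) (v := v)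
      change Var[id; gaussianReal 0 v] = v at h
      rw [variance_eq_sub (memLp_id_gaussianReal 2)] at h
      simpa using h.symm
    rw [h1, ← hv, integral_map hmY.aemeasurable (by fun_prop)]
    have i1 : Integrable (fun ω => X r ω * X r ω) P := hLr.integrable_mul hLr
    have i2 : Integrable (fun ω => X r ω * X s ω) P := hLr.integrable_mul hLs
    have i3 : Integrable (fun ω => X s ω * X s ω) P := hLs.integrable_mul hLs
    have h2 : ∀ ω, (ξ * X r ω + η * X s ω) ^ 2 = ξ ^ 2 * (X r ω * X r ω)
        + 2 * ξ * η * (X r ω * X s ω) + η ^ 2 * (X s ω * X s ω) := fun ω => by ring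
    simp_rw [h2]
    have i12 : Integrable (fun ω => ξ ^ 2 * (X r ω * X r ω) + 2 * ξ * η * (X r ω * X s ω)) P :=
      (i1.const_mul _).add (i2.const_mul _)
    rw [integral_add i12 (i3.const_mul _),
      integral_add (i1.const_mul _) (i2.const_mul _), integral_const_mul, integral_const_mul,
      integral_const_mul, hX.2 r r hr hr, hX.2 r s hr hs, hX.2 s s hs hs, bridgeVar]
  have h := charFun_gaussianReal (μ := 0) (v := v) 1
  rw [charFun_apply_real, ← hv, integral_map hmY.aemeasurable (by fun_prop)] at h
  simp only [Complex.ofReal_one, one_mul] at h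
  rw [h, ← hvar]
  congr 1
  push_cast
  ring

end CharFun

/-- Fourier representation of the Gaussian density of variance `ε`. -/
lemma gaussian_eq_integral_cexp {ε : ℝ} (hε : 0 < ε) (y : ℝ) :
    (((√(2 * π * ε))⁻¹ * Real.exp (-y ^ 2 / (2 * ε)) : ℝ) : ℂ)
      = ∫ ξ : ℝ, (((2 * π)⁻¹ * Real.exp (-(ε / 2) * ξ ^ 2) : ℝ) : ℂ)
          * Complex.exp (((ξ * y : ℝ) : ℂ) * Complex.I) := by
  have h := fourierIntegral_gaussian (b := ((ε / 2 : ℝ) : ℂ)) (by simpa using hε) (y : ℂ)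
  have h2 : ∀ ξ : ℝ, (((2 * π)⁻¹ * Real.exp (-(ε / 2) * ξ ^ 2) : ℝ) : ℂ)
          * Complex.exp (((ξ * y : ℝ) : ℂ) * Complex.I)
      = ((2 * π : ℝ) : ℂ)⁻¹ * (Complex.exp (Complex.I * y * ξ)
        * Complex.exp (-((ε / 2 : ℝ) : ℂ) * (ξ : ℂ) ^ 2)) := fun ξ => by
    push_cast
    rw [show Complex.I * y * ξ = ξ * y * Complex.I by ring]
    ring
  simp_rw [h2]
  rw [integral_const_mul, h]
  have h3 : ((π : ℂ) / ((ε / 2 : ℝ) : ℂ)) ^ (1 / 2 : ℂ) = ((√(2 * π / ε) : ℝ) : ℂ) := by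
    rw [Real.sqrt_eq_rpow, Complex.ofReal_cpow (by positivity)]
    congr 1
    · push_cast
      field_simp
    · push_cast; rfl
  have h4 : Complex.exp (-(y : ℂ) ^ 2 / (4 * ((ε / 2 : ℝ) : ℂ)))
      = ((Real.exp (-y ^ 2 / (2 * ε)) : ℝ) : ℂ) := by
    push_cast
    congr 1
    field_simp
    ring
  rw [h3, h4, ← mul_assoc]
  rw [← Complex.ofReal_inv, ← Complex.ofReal_mul, ← Complex.ofReal_mul]
  congr 2
  have h5 : √(2 * π) * √(2 * π) = 2 * π := Real.mul_self_sqrt (by positivity)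
  have h8 : √(2 * π * ε) = √(2 * π) * √ε := Real.sqrt_mul (by positivity) _
  have h9 : √(2 * π / ε) = √(2 * π) / √ε := Real.sqrt_div (by positivity) _
  have h6 : 0 < √(2 * π) := by positivity
  have h7 : 0 < √ε := by positivity
  rw [h8, h9]
  generalize √(2 * π) = w at *
  rw [← h5]
  field_simp

/-- The difference of the Fourier transforms of the Gaussian densities of variances `ε` and `θ`. -/
noncomputable def gaussDiff (ε θ ξ : ℝ) : ℝ :=
  Real.exp (-(ε / 2) * ξ ^ 2) - Real.exp (-(θ / 2) * ξ ^ 2)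

lemma continuous_gaussDiff (ε θ : ℝ) : Continuous (gaussDiff ε θ) := by
  unfold gaussDiff; fun_prop

lemma integrable_gaussDiff {ε θ : ℝ} (hε : 0 < ε) (hθ : 0 < θ) : Integrable (gaussDiff ε θ) :=
  (integrable_exp_neg_mul_sq (half_pos hε)).sub (integrable_exp_neg_mul_sq (half_pos hθ))

lemma abs_gaussDiff_le_one {ε θ : ℝ} (hε : 0 ≤ ε) (hθ : 0 ≤ θ) (ξ : ℝ) :
    |gaussDiff ε θ ξ| ≤ 1 := by
  have h : ∀ {a : ℝ}, 0 ≤ a → Real.exp (-(a / 2) * ξ ^ 2) ≤ 1 := fun ha => by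
    rw [Real.exp_le_one_iff, neg_mul, neg_nonpos]; positivity
  have h1 := Real.exp_pos (-(ε / 2) * ξ ^ 2)
  have h2 := Real.exp_pos (-(θ / 2) * ξ ^ 2)
  rw [gaussDiff, abs_le]
  constructor <;> linarith [h hε, h hθ]

lemma tendsto_gaussDiff (ξ : ℝ) :
    Tendsto (fun p : ℝ × ℝ => gaussDiff p.1 p.2 ξ) (nhds (0, 0)) (nhds 0) := by
  have : Continuous fun p : ℝ × ℝ => gaussDiff p.1 p.2 ξ := by
    unfold gaussDiff; fun_prop
  simpa [gaussDiff] using this.tendsto (0, 0)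

section LocApprox

variable {Ω : Type*} [MeasurableSpace Ω] {P : Measure Ω} {α : ℝ → ℝ} {X : ℝ → Ω → ℝ}

lemma locApprox_sub_eq (hm : Measurable (Function.uncurry X)) (x : ℝ) {t : ℝ} (ht : 0 ≤ t)
    {ε θ : ℝ} (hε : 0 < ε) (hθ : 0 < θ) (ω : Ω) :
    ((locApprox X x ε t ω - locApprox X x θ t ω : ℝ) : ℂ)
      = ∫ r in Ioc 0 t, ∫ ξ : ℝ, (((2 * π)⁻¹ * gaussDiff ε θ ξ : ℝ) : ℂ)
          * Complex.exp (((ξ * (X r ω - x) : ℝ) : ℂ) * Complex.I) := by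
  have hmω : Measurable fun r => X r ω := hm.comp (measurable_id.prodMk measurable_const)
  have hint : ∀ {a : ℝ}, 0 < a → Integrable
      (fun r => (√(2 * π * a))⁻¹ * Real.exp (-(X r ω - x) ^ 2 / (2 * a)))
      (volume.restrict (Ioc 0 t)) := fun {a} ha => by
    refine Integrable.of_bound (by fun_prop) (√(2 * π * a))⁻¹ (ae_of_all _ fun r => ?_)
    rw [Real.norm_of_nonneg (by positivity)]
    refine mul_le_of_le_one_right (by positivity) (Real.exp_le_one_iff.2 ?_)
    exact div_nonpos_of_nonpos_of_nonneg (neg_nonpos.2 (sq_nonneg _)) (by positivity)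
  have hF : ∀ {a : ℝ}, 0 < a → ∀ y : ℝ, Integrable fun ξ : ℝ =>
      (((2 * π)⁻¹ * Real.exp (-(a / 2) * ξ ^ 2) : ℝ) : ℂ)
        * Complex.exp (((ξ * y : ℝ) : ℂ) * Complex.I) := fun {a} ha y => by
    refine Integrable.mono' ((integrable_exp_neg_mul_sq (half_pos ha)).const_mul (2 * π)⁻¹)
      (by fun_prop) (ae_of_all _ fun ξ => ?_)
    rw [norm_mul, Complex.norm_exp_ofReal_mul_I, mul_one, Complex.norm_real,
      Real.norm_of_nonneg (by positivity)]
  rw [locApprox, locApprox, intervalIntegral.integral_of_le ht,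
    intervalIntegral.integral_of_le ht, ← integral_sub (hint hε) (hint hθ),
    ← integral_complex_ofReal]
  refine integral_congr_ae (ae_of_all _ fun r => ?_)
  simp only
  rw [Complex.ofReal_sub, gaussian_eq_integral_cexp hε, gaussian_eq_integral_cexp hθ,
    ← integral_sub (hF hε _) (hF hθ _)]
  refine integral_congr_ae (ae_of_all _ fun ξ => ?_)
  simp only [gaussDiff]
  push_cast
  ring

/-- The integrand of the Fourier representation of the second moment of
`locApprox X x ε t - locApprox X x θ t`. -/
noncomputable def fourierIntegrand (x ε θ : ℝ) (w : (ℝ × ℝ) × (ℝ × ℝ)) : ℂ :=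
  (((2 * π)⁻¹ * gaussDiff ε θ w.2.1 * ((2 * π)⁻¹ * gaussDiff ε θ w.2.2) : ℝ) : ℂ)
    * Complex.exp (((-((w.2.1 + w.2.2) * x) : ℝ) : ℂ) * Complex.I)

lemma continuous_fourierIntegrand (x ε θ : ℝ) : Continuous (fourierIntegrand x ε θ) := by
  have := continuous_gaussDiff ε θ
  unfold fourierIntegrand
  fun_prop

lemma norm_fourierIntegrand (x ε θ : ℝ) (w : (ℝ × ℝ) × (ℝ × ℝ)) :
    ‖fourierIntegrand x ε θ w‖
      = |(2 * π)⁻¹ * gaussDiff ε θ w.2.1 * ((2 * π)⁻¹ * gaussDiff ε θ w.2.2)| := by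
  rw [fourierIntegrand, norm_mul, Complex.norm_exp_ofReal_mul_I, mul_one, Complex.norm_real,
    Real.norm_eq_abs]

lemma integrable_fourierIntegrand (x t : ℝ) {ε θ : ℝ} (hε : 0 < ε) (hθ : 0 < θ) :
    Integrable (fourierIntegrand x ε θ)
      (((volume.restrict (Ioc 0 t)).prod (volume.restrict (Ioc 0 t))).prod volume) := by
  have hg := (integrable_gaussDiff hε hθ).const_mul (2 * π)⁻¹
  have h : Integrable (fun w : (ℝ × ℝ) × (ℝ × ℝ) =>
      (1 : ℝ) * ((2 * π)⁻¹ * gaussDiff ε θ w.2.1 * ((2 * π)⁻¹ * gaussDiff ε θ w.2.2)))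
      (((volume.restrict (Ioc 0 t)).prod (volume.restrict (Ioc 0 t))).prod volume) :=
    (integrable_const (1 : ℝ)).mul_prod (hg.mul_prod hg)
  refine h.mono (continuous_fourierIntegrand x ε θ).aestronglyMeasurable (ae_of_all _ fun w => ?_)
  rw [norm_fourierIntegrand, one_mul, Real.norm_eq_abs]

lemma locApprox_sub_sq_eq (hm : Measurable (Function.uncurry X)) (x : ℝ) {t : ℝ} (ht : 0 ≤ t)
    {ε θ : ℝ} (hε : 0 < ε) (hθ : 0 < θ) (ω : Ω) :
    (((locApprox X x ε t ω - locApprox X x θ t ω) ^ 2 : ℝ) : ℂ)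
      = ∫ w, fourierIntegrand x ε θ w
          * Complex.exp (((w.2.1 * X w.1.1 ω + w.2.2 * X w.1.2 ω : ℝ) : ℂ) * Complex.I)
        ∂(((volume.restrict (Ioc 0 t)).prod (volume.restrict (Ioc 0 t))).prod volume) := by
  have hmω : Measurable fun r => X r ω := hm.comp (measurable_id.prodMk measurable_const)
  rw [integral_prod]
  · rw [Complex.ofReal_pow, locApprox_sub_eq hm x ht hε hθ, sq, ← integral_prod_mul]
    refine integral_congr_ae (ae_of_all _ fun p => ?_)
    simp only
    rw [← integral_prod_mul]
    refine integral_congr_ae (ae_of_all _ fun z => ?_)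
    simp only [fourierIntegrand]
    have h : Complex.exp (((z.1 * (X p.1 ω - x) : ℝ) : ℂ) * Complex.I)
        * Complex.exp (((z.2 * (X p.2 ω - x) : ℝ) : ℂ) * Complex.I)
      = Complex.exp (((-((z.1 + z.2) * x) : ℝ) : ℂ) * Complex.I)
        * Complex.exp (((z.1 * X p.1 ω + z.2 * X p.2 ω : ℝ) : ℂ) * Complex.I) := by
      rw [← Complex.exp_add, ← Complex.exp_add]
      congr 1
      push_cast
      ring
    rw [mul_mul_mul_comm, h, ← mul_assoc, Complex.ofReal_mul (_ * _)]
  · refine (integrable_fourierIntegrand x t hε hθ).mono ?_ (ae_of_all _ fun w => ?_)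
    · exact (continuous_fourierIntegrand x ε θ).aestronglyMeasurable.mul
        (by fun_prop : Measurable _).aestronglyMeasurable
    · rw [norm_mul, Complex.norm_exp_ofReal_mul_I, mul_one]

lemma IsBridge.integral_locApprox_sub_sq [IsProbabilityMeasure P] (hX : IsBridge P α X)
    (hm : Measurable (Function.uncurry X)) (x : ℝ) {t : ℝ} (ht : 0 ≤ t)
    {ε θ : ℝ} (hε : 0 < ε) (hθ : 0 < θ) :
    ((∫ ω, (locApprox X x ε t ω - locApprox X x θ t ω) ^ 2 ∂P : ℝ) : ℂ)
      = ∫ w, fourierIntegrand x ε θ w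
          * Complex.exp ((-bridgeVar α w.1.1 w.1.2 w.2.1 w.2.2 / 2 : ℝ) : ℂ)
        ∂(((volume.restrict (Ioc 0 t)).prod (volume.restrict (Ioc 0 t))).prod volume) := by
  have hmr : ∀ r, Measurable (X r) := fun r => hm.comp (measurable_const.prodMk measurable_id)
  rw [← integral_complex_ofReal]
  simp_rw [locApprox_sub_sq_eq hm x ht hε hθ]
  rw [integral_integral_swap]
  · refine integral_congr_ae ?_
    have hmem : ∀ᵐ w ∂(((volume.restrict (Ioc 0 t)).prod (volume.restrict (Ioc 0 t))).prod
        (volume : Measure (ℝ × ℝ))), w.1 ∈ Ioc 0 t ×ˢ Ioc 0 t := by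
      refine Measure.quasiMeasurePreserving_fst.ae ?_
      rw [Measure.prod_restrict]
      exact ae_restrict_mem (measurableSet_Ioc.prod measurableSet_Ioc)
    filter_upwards [hmem] with w hw
    rw [integral_const_mul, hX.integral_cexp hmr hw.1.1.le hw.2.1.le]
  · have hfst : Measurable fun q : Ω × ((ℝ × ℝ) × (ℝ × ℝ)) => X q.2.1.1 q.1 :=
      hm.comp (by fun_prop : Measurable fun q : Ω × ((ℝ × ℝ) × (ℝ × ℝ)) => (q.2.1.1, q.1))
    have hsnd : Measurable fun q : Ω × ((ℝ × ℝ) × (ℝ × ℝ)) => X q.2.1.2 q.1 :=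
      hm.comp (by fun_prop : Measurable fun q : Ω × ((ℝ × ℝ) × (ℝ × ℝ)) => (q.2.1.2, q.1))
    have h := (integrable_fourierIntegrand x t hε hθ).comp_snd P
    refine h.mono ?_ (ae_of_all _ fun q => ?_)
    · exact h.aestronglyMeasurable.mul (by fun_prop : Measurable _).aestronglyMeasurable
    · simp only [Function.uncurry]
      rw [norm_mul, Complex.norm_exp_ofReal_mul_I, mul_one]

lemma IsBridge.tendsto_integral_locApprox_sub_sq [IsProbabilityMeasure P] (hX : IsBridge P α X)
    (hα : Continuous α) (hpos : ∀ u, 0 < α u)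
    (hm : Measurable (Function.uncurry X)) (x : ℝ) {t : ℝ} (ht : 0 ≤ t) :
    Tendsto (fun p : ℝ × ℝ => ∫ ω, (locApprox X x p.1 t ω - locApprox X x p.2 t ω) ^ 2 ∂P)
      ((nhdsWithin 0 (Ioi 0)) ×ˢ (nhdsWithin 0 (Ioi 0))) (nhds 0) := by
  set l : Filter (ℝ × ℝ) := (nhdsWithin 0 (Ioi 0)) ×ˢ (nhdsWithin 0 (Ioi 0))
  have hl_le : l ≤ nhds (0, 0) := by
    rw [nhds_prod_eq]
    exact Filter.prod_mono nhdsWithin_le_nhds nhdsWithin_le_nhds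
  have hl_pos : ∀ᶠ p in l, 0 < p.1 ∧ 0 < p.2 :=
    (eventually_mem_nhdsWithin (a := (0 : ℝ)) (s := Ioi 0)).prod_mk eventually_mem_nhdsWithin
  have hint := integrable_exp_neg_half_bridgeVar hα hpos ht
  have key : Tendsto (fun p : ℝ × ℝ => ∫ w, fourierIntegrand x p.1 p.2 w
          * Complex.exp ((-bridgeVar α w.1.1 w.1.2 w.2.1 w.2.2 / 2 : ℝ) : ℂ)
        ∂(((volume.restrict (Ioc 0 t)).prod (volume.restrict (Ioc 0 t))).prod volume))
      l (nhds (∫ _, (0 : ℂ)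
        ∂(((volume.restrict (Ioc 0 t)).prod (volume.restrict (Ioc 0 t))).prod
          (volume : Measure (ℝ × ℝ))))) := by
    refine tendsto_integral_filter_of_dominated_convergence
      (fun w => (2 * π)⁻¹ * (2 * π)⁻¹ * Real.exp (-bridgeVar α w.1.1 w.1.2 w.2.1 w.2.2 / 2))
      (Eventually.of_forall fun p => ?_) ?_ (hint.const_mul _) (ae_of_all _ fun w => ?_)
    · simp_rw [← Complex.ofReal_exp]
      exact (continuous_fourierIntegrand x p.1 p.2).aestronglyMeasurable.mul
        (Complex.continuous_ofReal.comp_aestronglyMeasurable hint.aestronglyMeasurable)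
    · filter_upwards [hl_pos] with p hp
      refine ae_of_all _ fun w => ?_
      rw [norm_mul, Complex.norm_exp_ofReal, norm_fourierIntegrand, abs_mul, abs_mul, abs_mul,
        abs_of_pos (by positivity : (0 : ℝ) < (2 * π)⁻¹)]
      have h1 := abs_gaussDiff_le_one hp.1.le hp.2.le w.2.1
      have h2 := abs_gaussDiff_le_one hp.1.le hp.2.le w.2.2
      refine mul_le_mul_of_nonneg_right ?_ (Real.exp_pos _).le
      gcongr
      · exact mul_le_of_le_one_right (by positivity) h1
      · exact mul_le_of_le_one_right (by positivity) h2
    · rw [tendsto_zero_iff_norm_tendsto_zero]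
      have h1 := (tendsto_gaussDiff w.2.1).mono_left hl_le
      have h2 := (tendsto_gaussDiff w.2.2).mono_left hl_le
      have h3 := (((h1.const_mul (2 * π)⁻¹).mul (h2.const_mul (2 * π)⁻¹)).abs).mul_const
        (Real.exp (-bridgeVar α w.1.1 w.1.2 w.2.1 w.2.2 / 2))
      simp only [mul_zero, abs_zero, zero_mul] at h3
      refine h3.congr fun p => ?_
      rw [norm_mul, Complex.norm_exp_ofReal, norm_fourierIntegrand]
  rw [integral_zero] at key
  have hre := (Complex.continuous_re.tendsto 0).comp key
  rw [Complex.zero_re] at hre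
  refine hre.congr' ?_
  filter_upwards [hl_pos] with p hp
  rw [Function.comp_apply, ← hX.integral_locApprox_sub_sq hm x ht hp.1 hp.2, Complex.ofReal_re]

end LocApprox

theorem stmt_8 {Ω : Type*} [MeasurableSpace Ω] (P : Measure Ω) [IsProbabilityMeasure P]
    (α : ℝ → ℝ) (X : ℝ → Ω → ℝ)
    (hα_pos : ∀ t ≥ (0:ℝ), 0 < α t)
    (hα_cont : ContinuousOn α (Set.Ici 0))
    (hX : IsBridge P α X)
    (hmeas : Measurable (Function.uncurry X)) :
    ∀ x : ℝ, ∀ t > (0:ℝ),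
      Tendsto (fun p : ℝ × ℝ =>
          ∫ ω, (locApprox X x p.1 t ω - locApprox X x p.2 t ω)^2 ∂P)
        ((nhdsWithin 0 (Set.Ioi 0)) ×ˢ (nhdsWithin 0 (Set.Ioi 0))) (nhds 0) := by
  intro x t ht
  have heq : EqOn α (fun u => α (max u 0)) (Ici 0) := fun u hu => by
    simp only [max_eq_left (mem_Ici.1 hu)]
  exact (hX.congr heq).tendsto_integral_locApprox_sub_sq
    (hα_cont.comp_continuous (by fun_prop) fun u => le_max_right u 0)
    (fun u => hα_pos _ (le_max_right u 0)) hmeas x ht.le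
end

section
/- Let (X_t)_{t≥0} be an infinite time horizon Brownian bridge whose coefficient α satisfies the growth conditions (i) and (ii), and assume furthermore that α satisfies the growth bound α(t) ≥ c t^ρ for all t ≥ t₀, for some c > 0, t₀ > 0 and ρ > 1. Then for every p ∈ (0,1) there exist a constant C_p and t₁ > 0 such that E|X_r|^{−p} ≤ C_p (α(r))^{p/2} for all r ≥ t₁. -/
open MeasureTheory ProbabilityTheory Real Filter Set

/-- A bound on the logarithmic derivative of `α` controls `α` on unit intervals. -/
lemma le_mul_exp_of_abs_deriv_div_le {α : ℝ → ℝ} {C u r : ℝ}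
    (hα_pos : ∀ t ≥ (0:ℝ), 0 < α t) (hα : ContDiffOn ℝ 1 α (Set.Ici 0))
    (hC : ∀ t ≥ (0:ℝ), |deriv α t / α t| ≤ C) (hu : 0 < u) (hur : u ≤ r) (hru : r ≤ u + 1) :
    α u ≤ α r * Real.exp C := by
  have hd : ∀ x ∈ Set.Ioi (0:ℝ), HasDerivAt (fun y => Real.log (α y)) (deriv α x / α x) x := by
    intro x hx
    have h1 : DifferentiableAt ℝ α x :=
      (hα.differentiableOn one_ne_zero).differentiableAt (Ici_mem_nhds hx)
    exact h1.hasDerivAt.log (hα_pos x (le_of_lt hx)).ne'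
  have hr : 0 < r := hu.trans_le hur
  have hmv := (convex_Ioi (0:ℝ)).norm_image_sub_le_of_norm_hasDerivWithin_le
    (fun x hx => (hd x hx).hasDerivWithinAt)
    (fun x hx => by simpa only [Real.norm_eq_abs] using hC x (le_of_lt hx))
    (Set.mem_Ioi.2 hr) (Set.mem_Ioi.2 hu)
  have hC0 : 0 ≤ C := (abs_nonneg _).trans (hC 0 le_rfl)
  have h2 : ‖u - r‖ ≤ 1 := by
    rw [Real.norm_eq_abs, abs_le]; constructor <;> linarith
  have h3 : Real.log (α u) ≤ Real.log (α r) + C := by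
    have := (le_abs_self _).trans (hmv.trans (mul_le_mul_of_nonneg_left h2 hC0))
    linarith
  have hau := hα_pos u hu.le
  have har := hα_pos r hr.le
  calc α u = Real.exp (Real.log (α u)) := (Real.exp_log hau).symm
    _ ≤ Real.exp (Real.log (α r) + C) := Real.exp_le_exp.2 h3
    _ = α r * Real.exp C := by rw [Real.exp_add, Real.exp_log har]

/-- The variance of the bridge at time `r` is at least a constant multiple of `1 / α r`. -/
lemma exp_div_le_Kker_self {α : ℝ → ℝ} {C r : ℝ}
    (hα_pos : ∀ t ≥ (0:ℝ), 0 < α t) (hα : ContDiffOn ℝ 1 α (Set.Ici 0))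
    (hC : ∀ t ≥ (0:ℝ), |deriv α t / α t| ≤ C) (hr : 1 < r) (har : 1 ≤ α r) :
    Real.exp (-2 * Real.exp C) / α r ≤ Kker α r r := by
  set δ := 1 / α r with hδ
  have hpos : 0 < α r := by linarith
  have hδ0 : 0 < δ := by positivity
  have hδ1 : δ ≤ 1 := by rw [hδ, div_le_one hpos]; exact har
  have hint : ∀ a b : ℝ, 0 ≤ a → 0 ≤ b → IntervalIntegrable α volume a b := fun a b ha hb =>
    (hα.continuousOn.mono fun x hx => (le_min ha hb).trans hx.1).intervalIntegrable
  have hA : ∀ u ∈ Set.Icc (r - δ) r, Aint α r - Aint α u ≤ Real.exp C := by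
    intro u hu
    have hu0 : 0 < u := by linarith [hu.1]
    have h1 : Aint α r - Aint α u = ∫ x in u..r, α x :=
      intervalIntegral.integral_interval_sub_left (hint 0 r le_rfl (by linarith))
        (hint 0 u le_rfl hu0.le)
    rw [h1]
    calc ∫ x in u..r, α x ≤ ∫ _ in u..r, α r * Real.exp C := by
          refine intervalIntegral.integral_mono_on hu.2 (hint u r hu0.le (by linarith))
            (by simp) fun x hx => ?_
          exact le_mul_exp_of_abs_deriv_div_le hα_pos hα hC (by linarith [hx.1]) hx.2
            (by linarith [hx.1, hu.1])
      _ = (r - u) * (α r * Real.exp C) := by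
          rw [intervalIntegral.integral_const, smul_eq_mul]
      _ ≤ δ * (α r * Real.exp C) := by
          gcongr
          linarith [hu.1]
      _ = Real.exp C := by rw [hδ]; field_simp
  have hcontA : ContinuousOn (Aint α) (Set.Icc 0 r) := by
    rw [← Set.uIcc_of_le (by linarith : (0:ℝ) ≤ r)]
    exact intervalIntegral.continuousOn_primitive_interval' (hint 0 r le_rfl (by linarith))
      Set.left_mem_uIcc
  have hcont : ContinuousOn (fun u => Real.exp (2 * Aint α u)) (Set.Icc 0 r) :=
    (continuousOn_const.mul hcontA).rexp
  have hint2 : ∀ a b : ℝ, a ∈ Set.Icc 0 r → b ∈ Set.Icc 0 r →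
      IntervalIntegrable (fun u => Real.exp (2 * Aint α u)) volume a b := fun a b ha hb =>
    (hcont.mono (Set.uIcc_subset_Icc ha hb)).intervalIntegrable
  have hmem0 : (0:ℝ) ∈ Set.Icc 0 r := ⟨le_rfl, by linarith⟩
  have hmemr : r ∈ Set.Icc 0 r := ⟨by linarith, le_rfl⟩
  have hmemδ : r - δ ∈ Set.Icc 0 r := ⟨by linarith, by linarith⟩
  have hlow : δ * Real.exp (2 * Aint α r - 2 * Real.exp C) ≤
      ∫ u in (0:ℝ)..r, Real.exp (2 * Aint α u) := by
    rw [← intervalIntegral.integral_add_adjacent_intervals (hint2 _ _ hmem0 hmemδ)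
      (hint2 _ _ hmemδ hmemr)]
    have h1 : 0 ≤ ∫ u in (0:ℝ)..(r - δ), Real.exp (2 * Aint α u) :=
      intervalIntegral.integral_nonneg hmemδ.1 fun u _ => (Real.exp_pos _).le
    have h2 : ∫ _ in (r - δ)..r, Real.exp (2 * Aint α r - 2 * Real.exp C) ≤
        ∫ u in (r - δ)..r, Real.exp (2 * Aint α u) := by
      refine intervalIntegral.integral_mono_on hmemδ.2 (by simp) (hint2 _ _ hmemδ hmemr)
        fun x hx => Real.exp_le_exp.2 ?_
      linarith [hA x hx]
    have h3 : ∫ _ in (r - δ)..r, Real.exp (2 * Aint α r - 2 * Real.exp C) =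
        δ * Real.exp (2 * Aint α r - 2 * Real.exp C) := by simp
    linarith
  unfold Kker
  rw [min_self]
  calc Real.exp (-2 * Real.exp C) / α r
      = Real.exp (-(Aint α r) - Aint α r) *
          (δ * Real.exp (2 * Aint α r - 2 * Real.exp C)) := by
        rw [mul_left_comm, ← Real.exp_add, hδ, div_eq_mul_inv, mul_comm, one_div]
        congr 2
        ring
    _ ≤ _ := by gcongr

/-- Scaling of the negative absolute moments of a centered Gaussian. -/
lemma integral_abs_rpow_gaussianReal (v : NNReal) (q : ℝ) :
    ∫ x, |x| ^ q ∂(gaussianReal 0 v) =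
      (v : ℝ) ^ (q / 2) * ∫ x, |x| ^ q ∂(gaussianReal 0 1) := by
  have h : gaussianReal 0 v = (gaussianReal 0 1).map (Real.sqrt v * ·) := by
    rw [gaussianReal_map_const_mul]
    congr 1
    · simp
    · ext; simp
  rw [h, integral_map (by fun_prop) (by fun_prop : Measurable _).aestronglyMeasurable,
    ← integral_const_mul]
  congr 1 with x
  rw [abs_mul, Real.mul_rpow (abs_nonneg _) (abs_nonneg _), abs_of_nonneg (Real.sqrt_nonneg _),
    Real.sqrt_eq_rpow, ← Real.rpow_mul v.coe_nonneg]
  congr 2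
  ring

/-- The marginals of the bridge are centered Gaussians with variance `Kker α r r`. -/
lemma IsBridge.exists_hasLaw {Ω : Type*} [MeasurableSpace Ω] {P : Measure Ω} {α : ℝ → ℝ}
    {X : ℝ → Ω → ℝ} (hX : IsBridge P α X) {r : ℝ} (hr : 0 ≤ r) :
    ∃ v : NNReal, HasLaw (X r) (gaussianReal 0 v) P ∧ (v : ℝ) = Kker α r r := by
  obtain ⟨v, hv⟩ := hX.1 1 (fun _ => 1) (fun _ => r) (fun _ => hr)
  simp only [Finset.univ_unique, one_mul, Finset.sum_const, Finset.card_singleton,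
    one_smul] at hv
  have hm : AEMeasurable (X r) P := by
    by_contra hn
    rw [Measure.map_of_not_aemeasurable hn] at hv
    exact IsProbabilityMeasure.ne_zero (gaussianReal 0 v) hv.symm
  refine ⟨v, ⟨hm, hv⟩, ?_⟩
  rw [← hX.2 r r hr hr]
  have h1 : ∫ x, x * x ∂(P.map (X r)) = ∫ ω, X r ω * X r ω ∂P :=
    integral_map hm (by fun_prop : Measurable fun x : ℝ => x * x).aestronglyMeasurable
  rw [← h1, hv, ← variance_id_gaussianReal (μ := 0) (v := v),
    variance_of_integral_eq_zero aemeasurable_id (by simp)]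
  simp [sq]

theorem stmt_10 {Ω : Type*} [MeasurableSpace Ω] (P : Measure Ω) [IsProbabilityMeasure P]
    (α : ℝ → ℝ) (X : ℝ → Ω → ℝ)
    (hα_pos : ∀ t ≥ (0:ℝ), 0 < α t)
    (hα_cont : ContinuousOn α (Set.Ici 0))
    (hgrowth : ∃ γ β : ℝ, GrowthCond α γ β)
    (c t₀ ρ : ℝ) (hc : 0 < c) (ht₀ : 0 < t₀) (hρ : 1 < ρ)
    (hlb : ∀ t ≥ t₀, c * t ^ ρ ≤ α t)
    (hX : IsBridge P α X) :
    ∀ p ∈ Set.Ioo (0:ℝ) 1, ∃ C > (0:ℝ), ∃ t₁ > (0:ℝ), ∀ r ≥ t₁,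
      ∫ ω, |X r ω| ^ (-p) ∂P ≤ C * (α r) ^ (p/2) := by
  rintro p ⟨hp0, -⟩
  obtain ⟨γ, β, hα, -, -, -, C, hC⟩ := hgrowth
  set M := ∫ x, |x| ^ (-p) ∂(gaussianReal 0 1) with hM
  have hM0 : 0 ≤ M := integral_nonneg fun x => Real.rpow_nonneg (abs_nonneg _) _
  set k := Real.exp (-2 * Real.exp C) with hk
  have hk0 : 0 < k := Real.exp_pos _
  have hlarge : ∀ᶠ t : ℝ in atTop, 1 ≤ c * t ^ ρ :=
    ((tendsto_rpow_atTop (by linarith)).const_mul_atTop hc).eventually_ge_atTop 1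
  obtain ⟨T, hT⟩ := eventually_atTop.1 hlarge
  refine ⟨k ^ (-p / 2) * (M + 1), by positivity, max (max T t₀) 2, by positivity, fun r hr => ?_⟩
  have hrT : T ≤ r := (le_max_left _ _).trans ((le_max_left _ _).trans hr)
  have hrt : t₀ ≤ r := (le_max_right _ _).trans ((le_max_left _ _).trans hr)
  have hr2 : 2 ≤ r := (le_max_right _ _).trans hr
  have har : 1 ≤ α r := (hT r hrT).trans (hlb r hrt)
  have har0 : 0 < α r := by linarith
  obtain ⟨v, hlaw, hv⟩ := hX.exists_hasLaw (by linarith : 0 ≤ r)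
  have hvlow : k / α r ≤ v :=
    hv ▸ exp_div_le_Kker_self hα_pos hα hC (by linarith) har
  have hmom : ∫ ω, |X r ω| ^ (-p) ∂P = (v : ℝ) ^ (-p / 2) * M := by
    rw [hM, ← integral_abs_rpow_gaussianReal, ← hlaw.map_eq,
      integral_map hlaw.aemeasurable (by fun_prop : Measurable _).aestronglyMeasurable]
  have hkα : (k / α r) ^ (-p / 2) = k ^ (-p / 2) * α r ^ (p / 2) := by
    rw [Real.div_rpow hk0.le har0.le, neg_div, Real.rpow_neg har0.le, div_inv_eq_mul]
  calc ∫ ω, |X r ω| ^ (-p) ∂P = (v : ℝ) ^ (-p / 2) * M := hmom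
    _ ≤ (k / α r) ^ (-p / 2) * (M + 1) := by
        gcongr ?_ * ?_
        · exact Real.rpow_le_rpow_of_nonpos (by positivity) hvlow (by linarith)
        · linarith
    _ = k ^ (-p / 2) * (M + 1) * α r ^ (p / 2) := by rw [hkα]; ring
end

section
/- Let α : [0,∞) → (0,∞) be continuous, let K be the associated covariance kernel, let p be a positive integer, and let 0 ≤ u₁ < u₂ < ⋯ < u_p < ∞. Let A_p(u) be the p×p matrix with entries a_{ij} = K(u_i, u_j), and set u₀ = 0. Then u₁(u₂ − u₁)⋯(u_p − u_{p−1}) · exp(−2 α*(u_p) u_p) ≤ det(A_p(u)) ≤ u₁(u₂ − u₁)⋯(u_p − u_{p−1}). -/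
open MeasureTheory ProbabilityTheory Real Filter Set

theorem det_of_mul_mul_min (p : ℕ) (c : Fin p → ℝ) (g : ℕ → ℝ) (hg : g 0 = 0) :
    (Matrix.of fun i j : Fin p => c i * c j * g (min (i : ℕ) j + 1)).det =
      ∏ i : Fin p, c i ^ 2 * (g (i + 1) - g i) := by
  let L : Matrix (Fin p) (Fin p) ℝ := Matrix.of fun i k => if k ≤ i then c i else 0
  have hL : L.det = ∏ i, c i := by
    rw [Matrix.det_of_isLowerTriangular]
    · simp [L]
    · intro i j hij
      have : i < j := hij
      simp [L, this]
  have hfac : (Matrix.of fun i j : Fin p => c i * c j * g (min (i : ℕ) j + 1)) =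
      L * Matrix.diagonal (fun k : Fin p => g (k + 1) - g k) * L.transpose := by
    ext i j
    have hsum : ∑ k ∈ Finset.range (min (i : ℕ) j + 1), (g (k + 1) - g k) =
        ∑ k : Fin p, if k ≤ i ∧ k ≤ j then g (k + 1) - g k else 0 := by
      simp only [Fin.le_def]
      rw [Fin.sum_univ_eq_sum_range
        (fun k : ℕ => if k ≤ (i : ℕ) ∧ k ≤ (j : ℕ) then g (k + 1) - g k else 0) p,
        ← Finset.sum_filter]
      refine Finset.sum_congr ?_ fun _ _ => rfl
      ext k
      simp only [Finset.mem_range, Finset.mem_filter]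
      omega
    rw [Finset.sum_range_sub, hg, sub_zero] at hsum
    rw [Matrix.mul_apply]
    simp only [Matrix.of_apply, Matrix.mul_diagonal, Matrix.transpose_apply, L, hsum,
      Finset.mul_sum]
    refine Finset.sum_congr rfl fun k _ => ?_
    by_cases hi : k ≤ i <;> by_cases hj : k ≤ j <;> simp [hi, hj]
    ring
  rw [hfac, Matrix.det_mul, Matrix.det_mul, Matrix.det_transpose, hL, Matrix.det_diagonal,
    ← Finset.prod_mul_distrib, ← Finset.prod_mul_distrib]
  exact Finset.prod_congr rfl fun i _ => by ring

theorem ContinuousOn.intervalIntegrable_of_Ici_zero {α : ℝ → ℝ}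
    (hα : ContinuousOn α (Set.Ici 0)) {a b : ℝ} (ha : 0 ≤ a) (hb : 0 ≤ b) :
    IntervalIntegrable α volume a b :=
  (hα.mono fun _ hx => (le_min ha hb).trans hx.1).intervalIntegrable

theorem Aint_monotoneOn {α : ℝ → ℝ} (hα_pos : ∀ t ≥ (0:ℝ), 0 < α t)
    (hα_cont : ContinuousOn α (Set.Ici 0)) : MonotoneOn (Aint α) (Set.Ici 0) := by
  intro a ha b hb hab
  rw [← sub_nonneg, Aint, Aint, intervalIntegral.integral_interval_sub_left
    (hα_cont.intervalIntegrable_of_Ici_zero le_rfl hb)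
    (hα_cont.intervalIntegrable_of_Ici_zero le_rfl ha)]
  exact intervalIntegral.integral_nonneg hab fun x hx => (hα_pos x (le_trans ha hx.1)).le

theorem Aint_le_alphaStar_mul {α : ℝ → ℝ} (hα_cont : ContinuousOn α (Set.Ici 0)) {t : ℝ}
    (ht : 0 ≤ t) : Aint α t ≤ alphaStar α t * t := by
  have hbdd : BddAbove (α '' Set.Icc 0 t) :=
    (isCompact_Icc.image_of_continuousOn (hα_cont.mono fun _ hx => hx.1)).bddAbove
  calc Aint α t ≤ ∫ _ in (0:ℝ)..t, alphaStar α t :=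
        intervalIntegral.integral_mono_on ht
          (hα_cont.intervalIntegrable_of_Ici_zero le_rfl ht) intervalIntegrable_const
          fun x hx => le_csSup hbdd ⟨x, hx, rfl⟩
    _ = alphaStar α t * t := by simp [mul_comm]

theorem MonotoneOn.intervalIntegral_bounds {f : ℝ → ℝ} {a b : ℝ} (hab : a ≤ b)
    (hf : MonotoneOn f (Set.Icc a b)) :
    f a * (b - a) ≤ ∫ x in a..b, f x ∧ ∫ x in a..b, f x ≤ f b * (b - a) := by
  have h_int : IntervalIntegrable f volume a b :=
    MonotoneOn.intervalIntegrable (by rwa [Set.uIcc_of_le hab])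
  constructor
  · calc f a * (b - a) = ∫ _ in a..b, f a := by simp [mul_comm]
      _ ≤ _ := intervalIntegral.integral_mono_on hab intervalIntegrable_const h_int
          fun x hx => hf (left_mem_Icc.2 hab) hx hx.1
  · calc _ ≤ ∫ _ in a..b, f b :=
          intervalIntegral.integral_mono_on hab h_int intervalIntegrable_const
            fun x hx => hf hx (right_mem_Icc.2 hab) hx.2
      _ = f b * (b - a) := by simp [mul_comm]

theorem exp_two_mul_Aint_increment_bounds {α : ℝ → ℝ} (hα_pos : ∀ t ≥ (0:ℝ), 0 < α t)
    (hα_cont : ContinuousOn α (Set.Ici 0)) {a b : ℝ} (ha : 0 ≤ a) (hab : a ≤ b) :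
    (b - a) * Real.exp (-2 * (Aint α b - Aint α a)) ≤ Real.exp (-Aint α b) ^ 2 *
        ((∫ x in (0:ℝ)..b, Real.exp (2 * Aint α x)) - ∫ x in (0:ℝ)..a, Real.exp (2 * Aint α x)) ∧
      Real.exp (-Aint α b) ^ 2 *
        ((∫ x in (0:ℝ)..b, Real.exp (2 * Aint α x)) - ∫ x in (0:ℝ)..a, Real.exp (2 * Aint α x)) ≤
        b - a := by
  have hm : MonotoneOn (fun x => Real.exp (2 * Aint α x)) (Set.Ici 0) := fun x hx y hy hxy =>
    Real.exp_le_exp.2 (by linarith [Aint_monotoneOn hα_pos hα_cont hx hy hxy])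
  have h_int : ∀ t : ℝ, 0 ≤ t →
      IntervalIntegrable (fun x => Real.exp (2 * Aint α x)) volume 0 t := fun t ht =>
    MonotoneOn.intervalIntegrable (hm.mono (by rw [Set.uIcc_of_le ht]; exact fun _ hx => hx.1))
  rw [intervalIntegral.integral_interval_sub_left (h_int b (ha.trans hab)) (h_int a ha)]
  obtain ⟨h₁, h₂⟩ := MonotoneOn.intervalIntegral_bounds hab
    (hm.mono fun x hx => ha.trans hx.1)
  have hsq : Real.exp (-Aint α b) ^ 2 = Real.exp (-2 * Aint α b) := by
    rw [← Real.exp_nat_mul]; push_cast; ring_nf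
  rw [hsq]
  constructor
  · calc (b - a) * Real.exp (-2 * (Aint α b - Aint α a))
        = Real.exp (-2 * Aint α b) * (Real.exp (2 * Aint α a) * (b - a)) := by
          rw [← mul_assoc, ← Real.exp_add]; ring_nf
      _ ≤ _ := by gcongr
  · calc _ ≤ Real.exp (-2 * Aint α b) * (Real.exp (2 * Aint α b) * (b - a)) := by gcongr
      _ = b - a := by
          rw [← mul_assoc, ← Real.exp_add]; simp

theorem stmt_14 (α : ℝ → ℝ)
    (hα_pos : ∀ t ≥ (0:ℝ), 0 < α t)
    (hα_cont : ContinuousOn α (Set.Ici 0))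
    (p : ℕ) (hp : 0 < p) (u : ℕ → ℝ)
    (hu0 : u 0 = 0) (hu1 : 0 ≤ u 1)
    (hmono : ∀ i : ℕ, 1 ≤ i → i < p → u i < u (i+1)) :
    (∏ i ∈ Finset.range p, (u (i+1) - u i)) *
        Real.exp (-(2 * alphaStar α (u p) * u p)) ≤
      (Matrix.of fun i j : Fin p => Kker α (u ((i:ℕ)+1)) (u ((j:ℕ)+1))).det ∧
    (Matrix.of fun i j : Fin p => Kker α (u ((i:ℕ)+1)) (u ((j:ℕ)+1))).det ≤
      ∏ i ∈ Finset.range p, (u (i+1) - u i) := by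
  have hstep : ∀ i < p, u i ≤ u (i + 1) := by
    intro i hi
    rcases Nat.eq_zero_or_pos i with rfl | h
    · simpa [hu0] using hu1
    · exact (hmono i h hi).le
  have hle : ∀ i j : ℕ, i ≤ j → j ≤ p → u i ≤ u j := by
    intro i j hij
    induction j, hij using Nat.le_induction with
    | base => exact fun _ => le_rfl
    | succ j _ ih => exact fun hj => (ih (by omega)).trans (hstep j (by omega))
  have hnn : ∀ i ≤ p, 0 ≤ u i := fun i hi => hu0 ▸ hle 0 i (Nat.zero_le i) hi
  let G : ℝ → ℝ := fun t => ∫ x in (0:ℝ)..t, Real.exp (2 * Aint α x)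
  have hdet : (Matrix.of fun i j : Fin p => Kker α (u ((i:ℕ)+1)) (u ((j:ℕ)+1))).det =
      ∏ i ∈ Finset.range p, Real.exp (-Aint α (u (i+1))) ^ 2 * (G (u (i+1)) - G (u i)) := by
    rw [← Fin.prod_univ_eq_prod_range
      (fun i => Real.exp (-Aint α (u (i+1))) ^ 2 * (G (u (i+1)) - G (u i))) p,
      ← det_of_mul_mul_min p (fun i => Real.exp (-Aint α (u (i+1)))) (fun n => G (u n))
        (by simp [G, hu0])]
    congr 1
    ext i j
    have hmin : min (u ((i:ℕ)+1)) (u ((j:ℕ)+1)) = u (min (i:ℕ) j + 1) := by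
      rcases le_total (i:ℕ) j with h | h
      · rw [min_eq_left h, min_eq_left (hle _ _ (by omega) (by omega))]
      · rw [min_eq_right h, min_eq_right (hle _ _ (by omega) (by omega))]
    simp only [Matrix.of_apply, Kker, hmin, G, ← Real.exp_add, sub_eq_add_neg]
  have hb := fun i (hi : i ∈ Finset.range p) =>
    exp_two_mul_Aint_increment_bounds hα_pos hα_cont (hnn i (Finset.mem_range.1 hi).le)
      (hstep i (Finset.mem_range.1 hi))
  have hd : ∀ i ∈ Finset.range p, 0 ≤ u (i + 1) - u i := fun i hi =>
    sub_nonneg.2 (hstep i (Finset.mem_range.1 hi))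
  rw [hdet]
  constructor
  · calc (∏ i ∈ Finset.range p, (u (i+1) - u i)) * Real.exp (-(2 * alphaStar α (u p) * u p))
        ≤ (∏ i ∈ Finset.range p, (u (i+1) - u i)) * Real.exp (-2 * Aint α (u p)) := by
          refine mul_le_mul_of_nonneg_left (Real.exp_le_exp.2 ?_) (Finset.prod_nonneg hd)
          linarith [Aint_le_alphaStar_mul hα_cont (hnn p le_rfl)]
      _ = ∏ i ∈ Finset.range p,
            (u (i+1) - u i) * Real.exp (-2 * (Aint α (u (i+1)) - Aint α (u i))) := by
          rw [Finset.prod_mul_distrib, ← Real.exp_sum, ← Finset.mul_sum,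
            Finset.sum_range_sub fun i => Aint α (u i)]
          simp [hu0, Aint]
      _ ≤ _ := Finset.prod_le_prod (fun i hi => mul_nonneg (hd i hi) (Real.exp_nonneg _))
          fun i hi => (hb i hi).1
  · exact Finset.prod_le_prod
      (fun i hi => (mul_nonneg (hd i hi) (Real.exp_nonneg _)).trans (hb i hi).1)
      fun i hi => (hb i hi).2
end
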